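/- The Laplacian of the Gauss map G = x ∧ y of the meridian surface M² is given at every (u,v) ∈ I × J by ΔG = ((f κ_α)² + κ² + g'²)/f² · x∧y − (κ'/f²) · x∧n₁ − (κ f'/f²) · y∧n₁ − ((f' g' − f (f κ_α)')/f²) · y∧n₂, where κ' = dκ/dv and all other primes denote d/du. -/

import Mathlib

open Matrix

noncomputable section

/-- The embedding of `ℝ³ = span{e₁,e₂,e₃}` into `ℝ⁴`. -/
def emb (p : Fin 3 → ℝ) : Fin 4 → ℝ := ![p 0, p 1, p 2, 0]

/-- The fourth standard basis vector `e₄` of `ℝ⁴`. -/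
def e4 : Fin 4 → ℝ := ![0, 0, 0, 1]

/-- Model of the bivector `a ∧ b ∈ Λ²ℝ⁴` as the antisymmetric matrix `aᵢbⱼ − aⱼbᵢ`. -/
def wedge (a b : Fin 4 → ℝ) : Fin 4 → Fin 4 → ℝ := fun i j => a i * b j - a j * b i

/-- The tangent `t = r'` of the spherical curve `r`. -/
def sphT (r : ℝ → Fin 3 → ℝ) : ℝ → Fin 3 → ℝ := deriv r

/-- The normal `n = r × t` of the spherical curve `r`. -/
def sphN (r : ℝ → Fin 3 → ℝ) (v : ℝ) : Fin 3 → ℝ := crossProduct (r v) (deriv r v)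

/-- The spherical curvature `κ = ⟨t', n⟩` of the spherical curve `r`. -/
def sphCurv (r : ℝ → Fin 3 → ℝ) (v : ℝ) : ℝ := deriv (deriv r) v ⬝ᵥ sphN r v

/-- The curvature `κ_α = f′g″ − g′f″` of the meridian curve `α = (f, g)`. -/
def merCurv (f g : ℝ → ℝ) (u : ℝ) : ℝ :=
  deriv f u * deriv (deriv g) u - deriv g u * deriv (deriv f) u

/-- The parametrization `z(u,v) = f(u) r(v) + g(u) e₄` of the meridian surface `M²`. -/
def mz (f g : ℝ → ℝ) (r : ℝ → Fin 3 → ℝ) (u v : ℝ) : Fin 4 → ℝ :=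
  f u • emb (r v) + g u • e4

/-- The tangent frame vector `x = ∂z/∂u = f′ r + g′ e₄`. -/
def mx (f g : ℝ → ℝ) (r : ℝ → Fin 3 → ℝ) (u v : ℝ) : Fin 4 → ℝ :=
  deriv f u • emb (r v) + deriv g u • e4

/-- The tangent frame vector `y = (1/f) ∂z/∂v = t`. -/
def my (r : ℝ → Fin 3 → ℝ) (v : ℝ) : Fin 4 → ℝ := emb (deriv r v)

/-- The normal frame vector `n₁ = n`. -/
def mn1 (r : ℝ → Fin 3 → ℝ) (v : ℝ) : Fin 4 → ℝ := emb (sphN r v)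

/-- The normal frame vector `n₂ = −g′ r + f′ e₄`. -/
def mn2 (f g : ℝ → ℝ) (r : ℝ → Fin 3 → ℝ) (u v : ℝ) : Fin 4 → ℝ :=
  (-(deriv g u)) • emb (r v) + deriv f u • e4

/-- The Gauss map `G = x ∧ y` of the meridian surface, with values in `Λ²ℝ⁴`. -/
def gaussG (f g : ℝ → ℝ) (r : ℝ → Fin 3 → ℝ) (u v : ℝ) : Fin 4 → Fin 4 → ℝ :=
  wedge (mx f g r u v) (my r v)

/-- The Laplacian `Δφ = −(∂²φ/∂u² + (1/f²) ∂²φ/∂v² + (f′/f) ∂φ/∂u)` of the meridian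
surface, acting on `Λ²ℝ⁴`-valued functions. -/
def surfLap (f : ℝ → ℝ) (φ : ℝ → ℝ → Fin 4 → Fin 4 → ℝ) (u v : ℝ) : Fin 4 → Fin 4 → ℝ :=
  -(deriv (deriv (fun s => φ s v)) u + (1 / f u ^ 2) • deriv (deriv (fun s => φ u s)) v
    + (deriv f u / f u) • deriv (fun s => φ s v) u)

/-- `h(x,x)`: the normal component (w.r.t. `{n₁, n₂}`) of `∇′ₓx = ∂x/∂u`. -/
def hxx (f g : ℝ → ℝ) (r : ℝ → Fin 3 → ℝ) (u v : ℝ) : Fin 4 → ℝ :=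
  (deriv (fun s => mx f g r s v) u ⬝ᵥ mn1 r v) • mn1 r v
    + (deriv (fun s => mx f g r s v) u ⬝ᵥ mn2 f g r u v) • mn2 f g r u v

/-- `h(x,y)`: the normal component (w.r.t. `{n₁, n₂}`) of `∇′_y x = (1/f) ∂x/∂v`. -/
def hxy (f g : ℝ → ℝ) (r : ℝ → Fin 3 → ℝ) (u v : ℝ) : Fin 4 → ℝ :=
  (((1 / f u) • deriv (fun s => mx f g r u s) v) ⬝ᵥ mn1 r v) • mn1 r v
    + (((1 / f u) • deriv (fun s => mx f g r u s) v) ⬝ᵥ mn2 f g r u v) • mn2 f g r u v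

/-- `h(y,y)`: the normal component (w.r.t. `{n₁, n₂}`) of `∇′_y y = (1/f) ∂y/∂v`. -/
def hyy (f g : ℝ → ℝ) (r : ℝ → Fin 3 → ℝ) (u v : ℝ) : Fin 4 → ℝ :=
  (((1 / f u) • deriv (my r) v) ⬝ᵥ mn1 r v) • mn1 r v
    + (((1 / f u) • deriv (my r) v) ⬝ᵥ mn2 f g r u v) • mn2 f g r u v

theorem emb_sub (p q : Fin 3 → ℝ) : emb (p - q) = emb p - emb q := by
  ext i; fin_cases i <;> simp [emb]

theorem emb_smul (c : ℝ) (p : Fin 3 → ℝ) : emb (c • p) = c • emb p := by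
  ext i; fin_cases i <;> simp [emb]

theorem HasDerivAt.emb {p : ℝ → Fin 3 → ℝ} {p' : Fin 3 → ℝ} {s : ℝ} (h : HasDerivAt p p' s) :
    HasDerivAt (fun s => emb (p s)) (emb p') s := by
  rw [hasDerivAt_pi] at h ⊢
  intro i
  fin_cases i
  · exact h 0
  · exact h 1
  · exact h 2
  · exact hasDerivAt_const s (0 : ℝ)

theorem HasDerivAt.wedge {a b : ℝ → Fin 4 → ℝ} {a' b' : Fin 4 → ℝ} {s : ℝ}
    (ha : HasDerivAt a a' s) (hb : HasDerivAt b b' s) :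
    HasDerivAt (fun s => wedge (a s) (b s)) (wedge a' (b s) + wedge (a s) b') s := by
  rw [hasDerivAt_pi] at ha hb
  refine hasDerivAt_pi.2 fun i => hasDerivAt_pi.2 fun j => ?_
  refine (((ha i).mul (hb j)).sub ((ha j).mul (hb i))).congr_deriv ?_
  simp only [_root_.wedge, Pi.add_apply]
  ring

theorem HasDerivAt.dotProduct {p q : ℝ → Fin 3 → ℝ} {p' q' : Fin 3 → ℝ} {s : ℝ}
    (hp : HasDerivAt p p' s) (hq : HasDerivAt q q' s) :
    HasDerivAt (fun s => p s ⬝ᵥ q s) (p' ⬝ᵥ q s + p s ⬝ᵥ q') s := by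
  rw [hasDerivAt_pi] at hp hq
  refine (HasDerivAt.fun_sum (u := Finset.univ) fun i _ => (hp i).mul (hq i)).congr_deriv ?_
  simp only [_root_.dotProduct, Finset.sum_add_distrib]

theorem HasDerivAt.crossProduct {p q : ℝ → Fin 3 → ℝ} {p' q' : Fin 3 → ℝ} {s : ℝ}
    (hp : HasDerivAt p p' s) (hq : HasDerivAt q q' s) :
    HasDerivAt (fun s => crossProduct (p s) (q s))
      (crossProduct p' (q s) + crossProduct (p s) q') s := by
  rw [hasDerivAt_pi] at hp hq
  refine hasDerivAt_pi.2 fun i => ?_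
  fin_cases i
  · refine (((hp 1).mul (hq 2)).sub ((hp 2).mul (hq 1))).congr_deriv ?_
    simp [cross_apply]; ring
  · refine (((hp 2).mul (hq 0)).sub ((hp 0).mul (hq 2))).congr_deriv ?_
    simp [cross_apply]; ring
  · refine (((hp 0).mul (hq 1)).sub ((hp 1).mul (hq 0))).congr_deriv ?_
    simp [cross_apply]; ring

/-- Expansion of a vector in the orthonormal basis `a, b, a × b` of `ℝ³`. -/
theorem eq_sum_orthonormal_cross {a b : Fin 3 → ℝ} (haa : a ⬝ᵥ a = 1) (hbb : b ⬝ᵥ b = 1)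
    (hab : a ⬝ᵥ b = 0) (c : Fin 3 → ℝ) :
    c = (c ⬝ᵥ a) • a + (c ⬝ᵥ b) • b + (c ⬝ᵥ crossProduct a b) • crossProduct a b := by
  have hnn : crossProduct a b ⬝ᵥ crossProduct a b = 1 := by
    rw [cross_dot_cross, haa, hbb, hab, dotProduct_comm b a, hab]; ring
  have han : a ⬝ᵥ crossProduct a b = 0 := dot_self_cross a b
  have hbn : b ⬝ᵥ crossProduct a b = 0 := dot_cross_self a b
  generalize crossProduct a b = n at *
  have hA : Matrix.of ![a, b, n] * (Matrix.of ![a, b, n])ᵀ = 1 := by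
    ext i j
    change ![a, b, n] i ⬝ᵥ ![a, b, n] j = _
    fin_cases i <;> fin_cases j <;>
      simp [haa, hbb, hab, hnn, han, hbn, dotProduct_comm b a, dotProduct_comm n a,
        dotProduct_comm n b]
  have hc : c = c ᵥ* ((Matrix.of ![a, b, n])ᵀ * Matrix.of ![a, b, n]) := by
    rw [mul_eq_one_comm.1 hA, vecMul_one]
  rw [← vecMul_vecMul] at hc
  conv_lhs => rw [hc]
  ext i
  simp [vecMul, Fin.sum_univ_three, dotProduct]

/-- A relation between functions on an open set may be differentiated. -/
theorem HasDerivAt.unique_of_eqOn {E : Type*} [NormedAddCommGroup E] [NormedSpace ℝ E]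
    {S : Set ℝ} (hS : IsOpen S) {p q : ℝ → E} (hpq : Set.EqOn p q S) {s : ℝ} (hs : s ∈ S)
    {p' q' : E} (hp : HasDerivAt p p' s) (hq : HasDerivAt q q' s) : p' = q' :=
  hp.unique (hq.congr_of_eventuallyEq (hpq.eventuallyEq_of_mem (hS.mem_nhds hs)))

theorem ContDiffOn.deriv_top {E : Type*} [NormedAddCommGroup E] [NormedSpace ℝ E]
    {S : Set ℝ} (hS : IsOpen S) {p : ℝ → E} (hp : ContDiffOn ℝ (⊤ : ℕ∞) p S) :
    ContDiffOn ℝ (⊤ : ℕ∞) (deriv p) S :=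
  hp.deriv_of_isOpen hS (by exact_mod_cast le_top)

theorem ContDiffOn.hasDerivAt_top {E : Type*} [NormedAddCommGroup E] [NormedSpace ℝ E]
    {S : Set ℝ} (hS : IsOpen S) {p : ℝ → E} (hp : ContDiffOn ℝ (⊤ : ℕ∞) p S) {s : ℝ}
    (hs : s ∈ S) : HasDerivAt p (deriv p s) s :=
  ((hp.differentiableOn (by simp)).differentiableAt (hS.mem_nhds hs)).hasDerivAt

/-- The first and second derivatives of a function whose first derivative is known on an
open set. -/
theorem deriv_deriv_of_hasDerivAt {E : Type*} [NormedAddCommGroup E] [NormedSpace ℝ E]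
    {S : Set ℝ} (hS : IsOpen S) {p p₁ : ℝ → E} (h : ∀ s ∈ S, HasDerivAt p (p₁ s) s)
    {s : ℝ} (hs : s ∈ S) {p₂ : E} (h₁ : HasDerivAt p₁ p₂ s) : deriv (deriv p) s = p₂ :=
  (h₁.congr_of_eventuallyEq
    (Set.EqOn.eventuallyEq_of_mem (fun x hx => (h x hx).deriv) (hS.mem_nhds hs))).deriv

section Spherical

variable {J : Set ℝ} {r : ℝ → Fin 3 → ℝ} {v : ℝ}

/-- Frenet equation `t' = κ n - r` of a spherical curve. -/
theorem spherical_deriv_tangent (hJ : IsOpen J) (hr : ContDiffOn ℝ (⊤ : ℕ∞) r J)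
    (hrs : ∀ v ∈ J, r v ⬝ᵥ r v = 1) (hra : ∀ v ∈ J, deriv r v ⬝ᵥ deriv r v = 1)
    (hv : v ∈ J) : deriv (deriv r) v = sphCurv r v • sphN r v - r v := by
  have h0 := fun {s} (hs : s ∈ J) => hr.hasDerivAt_top hJ hs
  have h1 := fun {s} (hs : s ∈ J) => (hr.deriv_top hJ).hasDerivAt_top hJ hs
  have hrt : ∀ s ∈ J, r s ⬝ᵥ deriv r s = 0 := fun s hs => by
    have h := HasDerivAt.unique_of_eqOn hJ hrs hs ((h0 hs).dotProduct (h0 hs))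
      (hasDerivAt_const s (1 : ℝ))
    rw [dotProduct_comm (deriv r s)] at h
    linarith
  have htt : deriv (deriv r) v ⬝ᵥ deriv r v = 0 := by
    have h := HasDerivAt.unique_of_eqOn hJ hra hv ((h1 hv).dotProduct (h1 hv))
      (hasDerivAt_const v (1 : ℝ))
    rw [dotProduct_comm (deriv r v)] at h
    linarith
  have htr : deriv (deriv r) v ⬝ᵥ r v = -1 := by
    have h := HasDerivAt.unique_of_eqOn hJ hrt hv ((h0 hv).dotProduct (h1 hv))
      (hasDerivAt_const v (0 : ℝ))
    rw [hra v hv, dotProduct_comm (r v)] at h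
    linarith
  have h := eq_sum_orthonormal_cross (hrs v hv) (hra v hv) (hrt v hv) (deriv (deriv r) v)
  rw [htt, htr] at h
  rw [h]
  simp only [sphCurv, sphN]
  module

/-- Frenet equation `n' = -κ t` of a spherical curve. -/
theorem spherical_hasDerivAt_normal (hJ : IsOpen J) (hr : ContDiffOn ℝ (⊤ : ℕ∞) r J)
    (hrs : ∀ v ∈ J, r v ⬝ᵥ r v = 1) (hra : ∀ v ∈ J, deriv r v ⬝ᵥ deriv r v = 1)
    (hv : v ∈ J) : HasDerivAt (sphN r) (-(sphCurv r v • deriv r v)) v := by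
  have h0 := fun {s} (hs : s ∈ J) => hr.hasDerivAt_top hJ hs
  have hrt : r v ⬝ᵥ deriv r v = 0 := by
    have h := HasDerivAt.unique_of_eqOn hJ hrs hv ((h0 hv).dotProduct (h0 hv))
      (hasDerivAt_const v (1 : ℝ))
    rw [dotProduct_comm (deriv r v)] at h
    linarith
  have hrr := hrs v hv
  refine ((h0 hv).crossProduct ((hr.deriv_top hJ).hasDerivAt_top hJ hv)).congr_deriv ?_
  have hrn : crossProduct (r v) (sphN r v) = -deriv r v := by
    simp only [vec3_dotProduct] at hrt hrr
    ext i
    fin_cases i <;> simp [sphN, cross_apply]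
    · linear_combination r v 0 * hrt - deriv r v 0 * hrr
    · linear_combination r v 1 * hrt - deriv r v 1 * hrr
    · linear_combination r v 2 * hrt - deriv r v 2 * hrr
  rw [spherical_deriv_tangent hJ hr hrs hra hv, map_sub, map_smul, hrn, cross_self, cross_self]
  module

theorem spherical_deriv_deriv_tangent (hJ : IsOpen J) (hr : ContDiffOn ℝ (⊤ : ℕ∞) r J)
    (hrs : ∀ v ∈ J, r v ⬝ᵥ r v = 1) (hra : ∀ v ∈ J, deriv r v ⬝ᵥ deriv r v = 1)
    (hv : v ∈ J) : deriv (deriv (deriv r)) v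
      = deriv (sphCurv r) v • sphN r v - (sphCurv r v ^ 2 + 1) • deriv r v := by
  have hN := spherical_hasDerivAt_normal hJ hr hrs hra hv
  have h3 := ((hr.deriv_top hJ).deriv_top hJ).hasDerivAt_top hJ hv
  have hκ : HasDerivAt (sphCurv r) (deriv (sphCurv r) v) v :=
    (h3.dotProduct hN).differentiableAt.hasDerivAt
  rw [HasDerivAt.unique_of_eqOn hJ (fun s hs => spherical_deriv_tangent hJ hr hrs hra hs) hv h3
    ((hκ.smul hN).sub (hr.hasDerivAt_top hJ hv))]
  module

end Spherical

section Meridian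

variable {I : Set ℝ} {f g : ℝ → ℝ} {u : ℝ}

/-- Frenet equations `f'' = -κ_α g'`, `g'' = κ_α f'` of the unit-speed meridian curve. -/
theorem meridian_deriv_deriv (hI : IsOpen I) (hf : ContDiffOn ℝ (⊤ : ℕ∞) f I)
    (hg : ContDiffOn ℝ (⊤ : ℕ∞) g I) (hfg : ∀ u ∈ I, deriv f u ^ 2 + deriv g u ^ 2 = 1)
    (hu : u ∈ I) : deriv (deriv f) u = -(merCurv f g u * deriv g u) ∧
      deriv (deriv g) u = merCurv f g u * deriv f u := by
  have hf2 := (hf.deriv_top hI).hasDerivAt_top hI hu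
  have hg2 := (hg.deriv_top hI).hasDerivAt_top hI hu
  have h := HasDerivAt.unique_of_eqOn hI hfg hu ((hf2.pow 2).add (hg2.pow 2))
    (hasDerivAt_const u (1 : ℝ))
  have h1 := hfg u hu
  norm_num at h
  unfold merCurv
  constructor
  · linear_combination -deriv (deriv f) u * h1 + deriv f u / 2 * h
  · linear_combination -deriv (deriv g) u * h1 + deriv g u / 2 * h

theorem merCurv_hasDerivAt (hI : IsOpen I) (hf : ContDiffOn ℝ (⊤ : ℕ∞) f I)
    (hg : ContDiffOn ℝ (⊤ : ℕ∞) g I) (hu : u ∈ I) :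
    HasDerivAt (merCurv f g) (deriv (merCurv f g) u) u := by
  have hf1 := hf.deriv_top hI
  have hg1 := hg.deriv_top hI
  exact (((hf1.hasDerivAt_top hI hu).mul ((hg1.deriv_top hI).hasDerivAt_top hI hu)).sub
    ((hg1.hasDerivAt_top hI hu).mul
      ((hf1.deriv_top hI).hasDerivAt_top hI hu))).differentiableAt.hasDerivAt

end Meridian

/-- The Laplacian of the Gauss map `G = x ∧ y` of the meridian surface:
`ΔG = ((fκ_α)² + κ² + g′²)/f² · x∧y − (κ′/f²) x∧n₁ − (κf′/f²) y∧n₁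
      − ((f′g′ − f(fκ_α)′)/f²) y∧n₂`. -/
theorem meridian_surface_laplacian_gauss_map
    (I J : Set ℝ) (hI : IsOpen I) (hIiv : I.OrdConnected) (hIne : I.Nonempty)
    (hJ : IsOpen J) (hJiv : J.OrdConnected) (hJne : J.Nonempty)
    (r : ℝ → Fin 3 → ℝ) (hr : ContDiffOn ℝ (⊤ : ℕ∞) r J)
    (hrs : ∀ v ∈ J, r v ⬝ᵥ r v = 1) (hra : ∀ v ∈ J, deriv r v ⬝ᵥ deriv r v = 1)
    (f g : ℝ → ℝ) (hf : ContDiffOn ℝ (⊤ : ℕ∞) f I) (hg : ContDiffOn ℝ (⊤ : ℕ∞) g I)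
    (hf0 : ∀ u ∈ I, f u ≠ 0) (hfg : ∀ u ∈ I, deriv f u ^ 2 + deriv g u ^ 2 = 1) :
    ∀ u ∈ I, ∀ v ∈ J,
      surfLap f (gaussG f g r) u v
        = (((f u * merCurv f g u) ^ 2 + sphCurv r v ^ 2 + deriv g u ^ 2) / f u ^ 2)
            • wedge (mx f g r u v) (my r v)
          - (deriv (sphCurv r) v / f u ^ 2) • wedge (mx f g r u v) (mn1 r v)
          - (sphCurv r v * deriv f u / f u ^ 2) • wedge (my r v) (mn1 r v)
          - ((deriv f u * deriv g u - f u * deriv (fun s => f s * merCurv f g s) u) / f u ^ 2)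
              • wedge (my r v) (mn2 f g r u v) := by
  intro u hu v hv
  have hf1 := hf.deriv_top hI
  have hg1 := hg.deriv_top hI
  have hr1 := hr.deriv_top hJ
  have hκα := merCurv_hasDerivAt hI hf hg hu
  have hF := fun {s} (hs : s ∈ I) => meridian_deriv_deriv hI hf hg hfg hs
  have hx : ∀ s ∈ I, HasDerivAt (fun s => mx f g r s v) (merCurv f g s • mn2 f g r s v) s := by
    intro s hs
    refine (((hf1.hasDerivAt_top hI hs).smul_const (emb (r v))).add
      ((hg1.hasDerivAt_top hI hs).smul_const e4)).congr_deriv ?_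
    rw [(hF hs).1, (hF hs).2, mn2]
    module
  have hn2 : HasDerivAt (fun s => mn2 f g r s v) (-(merCurv f g u • mx f g r u v)) u := by
    refine (((hg1.hasDerivAt_top hI hu).neg.smul_const (emb (r v))).add
      ((hf1.hasDerivAt_top hI hu).smul_const e4)).congr_deriv ?_
    rw [(hF hu).1, (hF hu).2, mx]
    module
  have hGu : ∀ s ∈ I, HasDerivAt (fun s => gaussG f g r s v)
      (wedge (merCurv f g s • mn2 f g r s v) (my r v) + wedge (mx f g r s v) 0) s :=
    fun s hs => (hx s hs).wedge (hasDerivAt_const s (my r v))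
  have hGuu := deriv_deriv_of_hasDerivAt hI hGu hu
    (((hκα.smul hn2).wedge (hasDerivAt_const u (my r v))).add
      ((hx u hu).wedge (hasDerivAt_const u 0)))
  have hxv : ∀ s ∈ J, HasDerivAt (fun s => mx f g r u s) (deriv f u • my r s) s := fun s hs =>
    ((hr.hasDerivAt_top hJ hs).emb.const_smul (deriv f u)).add_const _
  have hyv : ∀ s ∈ J, HasDerivAt (my r) (emb (deriv (deriv r) s)) s := fun s hs =>
    (hr1.hasDerivAt_top hJ hs).emb
  have hGvv := deriv_deriv_of_hasDerivAt hJ (fun s hs => (hxv s hs).wedge (hyv s hs)) hv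
    ((((hyv v hv).const_smul (deriv f u)).wedge (hyv v hv)).add
      ((hxv v hv).wedge ((hr1.deriv_top hJ).hasDerivAt_top hJ hv).emb))
  have hfκ := ((hf.hasDerivAt_top hI hu).mul hκα).deriv
  have hGv : (fun s => gaussG f g r u s) = fun s => wedge (mx f g r u s) (my r s) := rfl
  have hfκ' : deriv (fun s => f s * merCurv f g s) u
      = deriv f u * merCurv f g u + f u * deriv (merCurv f g) u := hfκ
  rw [surfLap, hGuu, hGv, hGvv, (hGu u hu).deriv, hfκ',
    spherical_deriv_deriv_tangent hJ hr hrs hra hv, spherical_deriv_tangent hJ hr hrs hra hv]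
  have h0 := hf0 u hu
  have h1 := hfg u hu
  simp only [emb_sub, emb_smul, mx, my, mn1, mn2]
  ext i j
  simp only [wedge, Pi.add_apply, Pi.sub_apply, Pi.neg_apply, Pi.smul_apply, smul_eq_mul,
    Pi.zero_apply, my]
  field_simp
  linear_combination -deriv g u * (e4 i * emb (deriv r v) j - e4 j * emb (deriv r v) i) * h1
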